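/- For every α ∈ (1, 3/2) and every constant c > 0 there exists δ > 0 with the following property: for every ε ∈ (0,1) there exists an integer N such that for all integers n ≥ N and all integers S with S ≥ n/c, there exists P ∈ M_S such that, under the Poissonized sampling model with parameter n, the plug-in (maximum-likelihood) estimator Ĥ_α(Z) = (1/(1−α))·ln( ∑_{i=1}^S (Z_i/n)^α ) (with the convention ln 0 = 0) satisfies P(|Ĥ_α(Z) − H_α(P)| ≥ δ) ≥ 1 − ε. -/

import Mathlib

open scoped BigOperators ENNReal

/-- The probability simplex on `S` outcomes. -/
def simplex (S : ℕ) : Set (Fin S → ℝ) :=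
  {P | (∀ i, 0 ≤ P i) ∧ ∑ i, P i = 1}

/-- Joint pmf of independent Poisson observations `Z i ~ Poisson (lam * P i)`. -/
noncomputable def poissonPMF (S : ℕ) (lam : ℝ) (P : Fin S → ℝ) (z : Fin S → ℕ) : ℝ :=
  ∏ i, Real.exp (-(lam * P i)) * (lam * P i) ^ (z i) / (Nat.factorial (z i) : ℝ)

open Classical in
/-- Probability of the event `A` under the Poissonized model. -/
noncomputable def poissonProb (S : ℕ) (lam : ℝ) (P : Fin S → ℝ)
    (A : Set (Fin S → ℕ)) : ℝ≥0∞ :=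
  ∑' z : Fin S → ℕ, if z ∈ A then ENNReal.ofReal (poissonPMF S lam P z) else 0

/-- The power-sum functional `F_α(P) = ∑ i, (P i)^α` (real power; `0^α = 0` for `α > 0`). -/
noncomputable def Falpha (S : ℕ) (α : ℝ) (P : Fin S → ℝ) : ℝ :=
  ∑ i, P i ^ α

/-- The Rényi entropy `H_α(P) = ln F_α(P) / (1 - α)`. -/
noncomputable def renyi (S : ℕ) (α : ℝ) (P : Fin S → ℝ) : ℝ :=
  (1 / (1 - α)) * Real.log (Falpha S α P)

open MeasureTheory

/-- The Poissonized model as a product of Poisson measures. -/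
lemma poissonProb_eq_pi (S : ℕ) {lam : ℝ} (hlam : 0 ≤ lam) {P : Fin S → ℝ} (hP : ∀ i, 0 ≤ P i)
    (A : Set (Fin S → ℕ)) :
    poissonProb S lam P A
      = Measure.pi (fun i => ProbabilityTheory.poissonMeasure (lam * P i).toNNReal) A := by
  classical
  rw [← Measure.tsum_indicator_apply_singleton _ A A.to_countable.measurableSet, poissonProb]
  refine tsum_congr fun z => ?_
  by_cases hz : z ∈ A
  · rw [if_pos hz, Set.indicator_of_mem hz, Measure.pi_singleton, poissonPMF,
      ENNReal.ofReal_prod_of_nonneg]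
    · refine Finset.prod_congr rfl fun i _ => ?_
      rw [ProbabilityTheory.poissonMeasure_singleton,
        Real.coe_toNNReal _ (mul_nonneg hlam (hP i))]
    · intro i _
      have := mul_nonneg hlam (hP i)
      positivity
  · rw [if_neg hz, Set.indicator_of_notMem hz]

section PoissonMoments

open ProbabilityTheory

lemma hasSum_poisson_mul_id (r : NNReal) :
    HasSum (fun k : ℕ => Real.exp (-r) * r ^ k / (k.factorial : ℝ) * k) (r : ℝ) := by
  rw [← hasSum_nat_add_iff' 1]
  convert! (hasSum_one_poissonMeasure r).mul_left (r : ℝ) using 1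
  · funext k
    rw [Nat.factorial_succ]
    push_cast
    have : ((k : ℝ) + 1) ≠ 0 := by positivity
    field_simp
    rw [pow_succ']
  · simp

lemma hasSum_poisson_mul_sq (r : NNReal) :
    HasSum (fun k : ℕ => Real.exp (-r) * r ^ k / (k.factorial : ℝ) * (k : ℝ) ^ 2)
      ((r : ℝ) * (r + 1)) := by
  rw [← hasSum_nat_add_iff' 1]
  convert! ((hasSum_poisson_mul_id r).add (hasSum_one_poissonMeasure r)).mul_left (r : ℝ)
    using 1
  · funext k
    rw [Nat.factorial_succ]
    push_cast
    have : ((k : ℝ) + 1) ≠ 0 := by positivity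
    field_simp
    rw [pow_succ']
  · simp

lemma integrable_natCast_poissonMeasure (r : NNReal) :
    Integrable (fun k : ℕ => (k : ℝ)) (poissonMeasure r) := by
  rw [integrable_poissonMeasure_iff]
  simpa using (hasSum_poisson_mul_id r).summable

lemma integrable_natCast_sq_poissonMeasure (r : NNReal) :
    Integrable (fun k : ℕ => (k : ℝ) ^ 2) (poissonMeasure r) := by
  rw [integrable_poissonMeasure_iff]
  simpa using (hasSum_poisson_mul_sq r).summable

lemma integral_natCast_poissonMeasure (r : NNReal) :
    ∫ k : ℕ, (k : ℝ) ∂poissonMeasure r = r := by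
  rw [integral_poissonMeasure]
  exact (hasSum_poisson_mul_id r).tsum_eq

lemma integral_natCast_sq_poissonMeasure (r : NNReal) :
    ∫ k : ℕ, (k : ℝ) ^ 2 ∂poissonMeasure r = r * (r + 1) := by
  rw [integral_poissonMeasure]
  exact (hasSum_poisson_mul_sq r).tsum_eq

lemma integrable_sq_natCast_sub_poissonMeasure (r : NNReal) :
    Integrable (fun k : ℕ => ((k : ℝ) - r) ^ 2) (poissonMeasure r) := by
  simp_rw [sub_sq]
  exact ((integrable_natCast_sq_poissonMeasure r).sub
    (((integrable_natCast_poissonMeasure r).const_mul 2).mul_const _)).add (integrable_const _)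

lemma integral_sq_natCast_sub_poissonMeasure (r : NNReal) :
    ∫ k : ℕ, ((k : ℝ) - r) ^ 2 ∂poissonMeasure r = r := by
  simp_rw [sub_sq]
  have h1 := ((integrable_natCast_poissonMeasure r).const_mul 2).mul_const (r : ℝ)
  have h2 : Integrable (fun k : ℕ => (k : ℝ) ^ 2 - 2 * k * r) (poissonMeasure r) :=
    (integrable_natCast_sq_poissonMeasure r).sub h1
  rw [integral_add h2 (integrable_const _),
    integral_sub (integrable_natCast_sq_poissonMeasure r) h1, integral_mul_const,
    integral_const_mul, integral_natCast_poissonMeasure, integral_natCast_sq_poissonMeasure]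
  simp
  ring

end PoissonMoments

/-- A lower bound for `(k / r) ^ α - 1`: the tangent line at `r` together with the Jensen gap
at `k = 0`. -/
noncomputable def tangentGap (α r : ℝ) (k : ℕ) : ℝ :=
  α / r * ((k : ℝ) - r) + (α - 1) * ({0} : Set ℕ).indicator 1 k

lemma one_add_tangentGap_le {α r : ℝ} (hα : 1 < α) (hr : 0 < r) (k : ℕ) :
    1 + tangentGap α r k ≤ ((k : ℝ) / r) ^ α := by
  have hk : α / r * ((k : ℝ) - r) = α * ((k : ℝ) / r - 1) := by field_simp
  rw [tangentGap, hk]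
  rcases Nat.eq_zero_or_pos k with rfl | hpos
  · have : (0 : ℝ) ^ α = 0 := Real.zero_rpow (by linarith)
    simp only [this, Nat.cast_zero, zero_div, Set.mem_singleton_iff, Set.indicator_of_mem,
      Pi.one_apply]
    linarith
  · have h := one_add_mul_self_le_rpow_one_add (s := (k : ℝ) / r - 1)
      (by have : 0 ≤ (k : ℝ) / r := by positivity
          linarith) hα.le
    rw [add_sub_cancel] at h
    simpa [hpos.ne'] using h

section TangentGapMoments

open ProbabilityTheory

lemma tangentGap_sq_le {α : ℝ} (r : ℝ) (k : ℕ) :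
    tangentGap α r k ^ 2 ≤ 2 * (α / r) ^ 2 * ((k : ℝ) - r) ^ 2 + 2 * (α - 1) ^ 2 := by
  rw [tangentGap]
  set x := α / r * ((k : ℝ) - r) with hx
  have hx2 : 2 * (α / r) ^ 2 * ((k : ℝ) - r) ^ 2 = 2 * x ^ 2 := by rw [hx]; ring
  rw [hx2]
  by_cases h : k = 0
  · simp only [h, Set.mem_singleton_iff, Set.indicator_of_mem, Pi.one_apply]
    nlinarith [sq_nonneg (x - (α - 1))]
  · simp only [Set.mem_singleton_iff, h, not_false_eq_true, Set.indicator_of_notMem]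
    nlinarith [sq_nonneg x, sq_nonneg (α - 1)]

lemma integrable_tangentGap_sq_bound (α : ℝ) (r : NNReal) :
    Integrable (fun k : ℕ => 2 * (α / r) ^ 2 * ((k : ℝ) - r) ^ 2 + 2 * (α - 1) ^ 2)
      (poissonMeasure r) :=
  ((integrable_sq_natCast_sub_poissonMeasure r).const_mul _).add (integrable_const _)

lemma memLp_tangentGap (α : ℝ) (r : NNReal) :
    MemLp (tangentGap α r) 2 (poissonMeasure r) := by
  rw [memLp_two_iff_integrable_sq (by fun_prop)]
  refine (integrable_tangentGap_sq_bound α r).mono' (by fun_prop) (.of_forall fun k => ?_)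
  rw [Real.norm_of_nonneg (sq_nonneg _)]
  exact tangentGap_sq_le (r : ℝ) k

lemma integral_tangentGap (α : ℝ) (r : NNReal) :
    ∫ k, tangentGap α r k ∂poissonMeasure r = (α - 1) * Real.exp (-r) := by
  have h1 : Integrable (fun k : ℕ => (k : ℝ) - r) (poissonMeasure r) :=
    (integrable_natCast_poissonMeasure r).sub (integrable_const _)
  have h2 : Integrable (({0} : Set ℕ).indicator (1 : ℕ → ℝ)) (poissonMeasure r) :=
    (integrable_const (1 : ℝ)).indicator (measurableSet_singleton 0)
  unfold tangentGap
  rw [integral_add (h1.const_mul _) (h2.const_mul _), integral_const_mul, integral_const_mul,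
    integral_sub (integrable_natCast_poissonMeasure r) (integrable_const _),
    integral_natCast_poissonMeasure, integral_indicator_one (measurableSet_singleton 0),
    poissonMeasure_real_singleton]
  simp

lemma variance_tangentGap_le (α : ℝ) {r : NNReal} (hr : 0 < r) :
    Var[tangentGap α r; poissonMeasure r] ≤ 2 * α ^ 2 / r + 2 * (α - 1) ^ 2 := by
  have hr' : (0 : ℝ) < r := hr
  calc Var[tangentGap α r; poissonMeasure r]
      ≤ ∫ k, tangentGap α r k ^ 2 ∂poissonMeasure r :=
        variance_le_expectation_sq (by fun_prop)
    _ ≤ ∫ k : ℕ, (2 * (α / r) ^ 2 * ((k : ℝ) - r) ^ 2 + 2 * (α - 1) ^ 2) ∂poissonMeasure r :=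
        integral_mono (memLp_tangentGap α r).integrable_sq
          (integrable_tangentGap_sq_bound α r) (tangentGap_sq_le (r : ℝ))
    _ = 2 * α ^ 2 / r + 2 * (α - 1) ^ 2 := by
        rw [integral_add ((integrable_sq_natCast_sub_poissonMeasure r).const_mul _)
          (integrable_const _), integral_const_mul, integral_sq_natCast_sub_poissonMeasure]
        simp
        field_simp

/-- Chebyshev's inequality for a sum of functions of independent coordinates, restricted to a
subset of the coordinates on which mean and variance are controlled. -/
lemma measure_pi_sum_lt_le {ι Ω : Type*} [Fintype ι] [MeasurableSpace Ω]
    {μ : ι → Measure Ω} [∀ i, IsProbabilityMeasure (μ i)] {f : Ω → ℝ} {I : Finset ι}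
    {a V t : ℝ} (ht : 0 < t) (hI : I.Nonempty) (hf : ∀ i ∈ I, MemLp f 2 (μ i))
    (hmean : ∀ i ∈ I, a ≤ ∫ x, f x ∂μ i) (hvar : ∀ i ∈ I, Var[f; μ i] ≤ V) :
    Measure.pi μ {z | ∑ i ∈ I, f (z i) < I.card * (a - t)}
      ≤ ENNReal.ofReal (V / (I.card * t ^ 2)) := by
  classical
  have hcard : (0 : ℝ) < I.card := by exact_mod_cast hI.card_pos
  set X : ι → Ω → ℝ := fun i => if i ∈ I then f else 0 with hX
  have hXL : ∀ i, MemLp (X i) 2 (μ i) := fun i => by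
    by_cases hi : i ∈ I
    · simpa [hX, hi] using hf i hi
    · simp [hX, hi]
  have hXL' : ∀ i, MemLp (fun z : ι → Ω => X i (z i)) 2 (Measure.pi μ) := fun i =>
    (hXL i).comp_measurePreserving (measurePreserving_eval _ i)
  have hWL : MemLp (∑ i, fun z : ι → Ω => X i (z i)) 2 (Measure.pi μ) :=
    memLp_finsetSum' _ fun i _ => hXL' i
  have hsum : ∀ z : ι → Ω, (∑ i, fun z : ι → Ω => X i (z i)) z = ∑ i ∈ I, f (z i) := by
    intro z
    rw [Finset.sum_apply, ← Finset.sum_filter_add_sum_filter_not Finset.univ (· ∈ I)]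
    simp only [hX]
    rw [Finset.sum_eq_zero (s := Finset.univ.filter (· ∉ I)) (by
      intro i hi; simp [(Finset.mem_filter.1 hi).2]), add_zero]
    simp only [Finset.filter_univ_mem]
    exact Finset.sum_congr rfl fun i hi => by simp [hi]
  have hE : I.card * a ≤ ∫ z, (∑ i, fun z : ι → Ω => X i (z i)) z ∂Measure.pi μ := by
    have hfi : ∀ i ∈ I, Integrable (fun z : ι → Ω => f (z i)) (Measure.pi μ) := fun i hi =>
      ((hf i hi).comp_measurePreserving (measurePreserving_eval _ i)).integrable one_le_two
    simp_rw [hsum]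
    rw [integral_finsetSum _ hfi, ← nsmul_eq_mul]
    refine Finset.card_nsmul_le_sum _ _ _ fun i hi => ?_
    rw [integral_comp_eval (hf i hi).aestronglyMeasurable]
    exact hmean i hi
  have hV : Var[∑ i, fun z : ι → Ω => X i (z i); Measure.pi μ] ≤ I.card * V := by
    rw [variance_sum_pi hXL, ← Finset.sum_subset (Finset.subset_univ I), ← nsmul_eq_mul]
    · refine Finset.sum_le_card_nsmul _ _ _ fun i hi => ?_
      simpa [hX, hi] using hvar i hi
    · intro i _ hi
      simp [hX, hi]
  calc Measure.pi μ {z | ∑ i ∈ I, f (z i) < I.card * (a - t)}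
      ≤ Measure.pi μ {z | I.card * t ≤ |(∑ i, fun z : ι → Ω => X i (z i)) z
          - ∫ z, (∑ i, fun z : ι → Ω => X i (z i)) z ∂Measure.pi μ|} := by
        refine measure_mono fun z hz => ?_
        rw [Set.mem_ofPred_eq] at hz ⊢
        rw [hsum z, abs_sub_comm]
        refine le_trans ?_ (le_abs_self _)
        linarith
    _ ≤ _ := meas_ge_le_variance_div_sq hWL (by positivity)
    _ ≤ _ := by
        refine ENNReal.ofReal_le_ofReal ?_
        calc _ ≤ I.card * V / (I.card * t) ^ 2 := by gcongr
          _ = _ := by field_simp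

end TangentGapMoments

/-- The uniform distribution on the first `m` of `S` outcomes. -/
noncomputable def uniformOnFirst (S m : ℕ) (i : Fin S) : ℝ :=
  if (i : ℕ) < m then 1 / (m : ℝ) else 0

lemma card_filter_val_lt {S m : ℕ} (h : m ≤ S) :
    (Finset.univ.filter fun i : Fin S => (i : ℕ) < m).card = m := by
  rw [Fin.card_filter_val_lt, min_eq_right h]

lemma uniformOnFirst_mem_simplex {S m : ℕ} (hm : 0 < m) (h : m ≤ S) :
    uniformOnFirst S m ∈ simplex S := by
  refine ⟨fun i => ?_, ?_⟩
  · unfold uniformOnFirst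
    split_ifs <;> positivity
  · unfold uniformOnFirst
    rw [← Finset.sum_filter, Finset.sum_const, card_filter_val_lt h, nsmul_eq_mul]
    field_simp

lemma Falpha_uniformOnFirst {S m : ℕ} (h : m ≤ S) {α : ℝ} (hα : 0 < α) :
    Falpha S α (uniformOnFirst S m) = m * (1 / (m : ℝ)) ^ α := by
  have hterm : ∀ i : Fin S,
      uniformOnFirst S m i ^ α = if (i : ℕ) < m then (1 / (m : ℝ)) ^ α else 0 := fun i => by
    unfold uniformOnFirst
    split_ifs
    · rfl
    · exact Real.zero_rpow hα.ne'
  simp_rw [Falpha, hterm]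
  rw [← Finset.sum_filter, Finset.sum_const, card_filter_val_lt h, nsmul_eq_mul]

/-- If the normalised tangent gaps sum to at least `m * t`, the plug-in power sum overshoots the
true one by the factor `1 + t`. -/
lemma mul_Falpha_uniformOnFirst_le {S m n : ℕ} (hm : 0 < m) (hn : 0 < n) (h : m ≤ S) {α t : ℝ}
    (hα : 1 < α) {z : Fin S → ℕ}
    (hz : m * t ≤ ∑ i with (i : Fin S).val < m, tangentGap α (n / m) (z i)) :
    (1 + t) * Falpha S α (uniformOnFirst S m) ≤ ∑ i, ((z i : ℝ) / n) ^ α := by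
  have hm' : (0 : ℝ) < m := by exact_mod_cast hm
  have hn' : (0 : ℝ) < n := by exact_mod_cast hn
  rw [Falpha_uniformOnFirst h (by linarith)]
  calc (1 + t) * (m * (1 / (m : ℝ)) ^ α)
      = (1 / (m : ℝ)) ^ α * (m + m * t) := by ring
    _ ≤ (1 / (m : ℝ)) ^ α *
          (m + ∑ i with (i : Fin S).val < m, tangentGap α (n / m) (z i)) := by gcongr
    _ = ∑ i with (i : Fin S).val < m,
          (1 / (m : ℝ)) ^ α * (1 + tangentGap α (n / m) (z i)) := by
        rw [← Finset.mul_sum, Finset.sum_add_distrib, Finset.sum_const, card_filter_val_lt h,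
          nsmul_eq_mul, mul_one]
    _ ≤ ∑ i with (i : Fin S).val < m, ((z i : ℝ) / n) ^ α := by
        refine Finset.sum_le_sum fun i _ => ?_
        calc _ ≤ (1 / (m : ℝ)) ^ α * ((z i : ℝ) / (n / m)) ^ α := by
              gcongr
              exact one_add_tangentGap_le hα (by positivity) _
          _ = _ := by
              rw [← Real.mul_rpow (by positivity) (by positivity)]
              congr 1
              field_simp
    _ ≤ ∑ i, ((z i : ℝ) / n) ^ α :=
        Finset.sum_le_sum_of_subset_of_nonneg (Finset.filter_subset _ _)
          fun i _ _ => by positivity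

lemma log_div_le_abs_renyi_diff {α t F G : ℝ} (hα : 1 < α) (ht : 0 < t) (hF : 0 < F)
    (hG : (1 + t) * F ≤ G) :
    Real.log (1 + t) / (α - 1)
      ≤ |(1 / (1 - α)) * Real.log G - (1 / (1 - α)) * Real.log F| := by
  have hlog : Real.log (1 + t) + Real.log F ≤ Real.log G := by
    rw [← Real.log_mul (by linarith) hF.ne']
    exact Real.log_le_log (by positivity) hG
  have hα' : 0 < α - 1 := by linarith
  have hα'' : 1 - α ≠ 0 := by linarith
  have : (1 / (1 - α)) * Real.log G - (1 / (1 - α)) * Real.log F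
      = -((Real.log G - Real.log F) / (α - 1)) := by
    field_simp
    ring
  rw [this, abs_neg]
  refine le_trans ?_ (le_abs_self _)
  gcongr
  linarith

theorem renyi_plugin_lower_bound (α : ℝ) (hα1 : 1 < α) (hα2 : α < 3 / 2)
    (c : ℝ) (hc : 0 < c) :
    ∃ δ : ℝ, 0 < δ ∧
      ∀ ε : ℝ, 0 < ε → ε < 1 →
        ∃ N : ℕ, ∀ n : ℕ, N ≤ n → ∀ S : ℕ, (n : ℝ) / c ≤ (S : ℝ) →
          ∃ P ∈ simplex S,
            ENNReal.ofReal (1 - ε)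
              ≤ poissonProb S (n : ℝ) P
                  {z | δ ≤ |(1 / (1 - α)) *
                      Real.log (∑ i, ((z i : ℝ) / (n : ℝ)) ^ α) - renyi S α P|} := by
  have hα' : 0 < α - 1 := by linarith
  set t : ℝ := (α - 1) * Real.exp (-c) / 2 with ht_def
  have ht : 0 < t := by positivity
  set V : ℝ := 4 * α ^ 2 / c + 2 * (α - 1) ^ 2 with hV_def
  have hV : 0 < V := by positivity
  refine ⟨Real.log (1 + t) / (α - 1), div_pos (Real.log_pos (by linarith)) hα', ?_⟩
  intro ε hε hε1
  obtain ⟨N, hN⟩ := exists_nat_ge (1 + c + c * (V / (ε * t ^ 2)))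
  refine ⟨N, fun n hn S hS => ?_⟩
  have hnN : 1 + c + c * (V / (ε * t ^ 2)) ≤ n := hN.trans (by exact_mod_cast hn)
  have hpos : 0 < c * (V / (ε * t ^ 2)) := by positivity
  have hn0 : (0 : ℝ) < n := by linarith
  set m : ℕ := ⌈(n : ℝ) / c⌉₊ with hm_def
  have hm0 : 0 < m := Nat.ceil_pos.2 (by positivity)
  have hm0' : (0 : ℝ) < m := by exact_mod_cast hm0
  have hmS : m ≤ S := Nat.ceil_le.2 hS
  have hm_ge : (n : ℝ) / c ≤ m := Nat.le_ceil _
  have hm_le : (m : ℝ) ≤ 2 * n / c := by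
    have h1 : (m : ℝ) < n / c + 1 := Nat.ceil_lt_add_one (by positivity)
    have h2 : 1 ≤ (n : ℝ) / c := by rw [le_div_iff₀ hc]; linarith
    have h3 : 2 * (n : ℝ) / c = n / c + n / c := by ring
    linarith
  have hr_le : (n : ℝ) / m ≤ c := by
    rw [div_le_iff₀ hm0']
    rw [div_le_iff₀ hc] at hm_ge
    linarith
  have hr_ge : c / 2 ≤ (n : ℝ) / m := by
    rw [div_le_div_iff₀ two_pos hm0']
    rw [le_div_iff₀ hc] at hm_le
    linarith
  have hP := uniformOnFirst_mem_simplex hm0 hmS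
  refine ⟨uniformOnFirst S m, hP, ?_⟩
  rw [poissonProb_eq_pi S hn0.le hP.1]
  set μ : Fin S → Measure ℕ := fun i =>
    ProbabilityTheory.poissonMeasure ((n : ℝ) * uniformOnFirst S m i).toNNReal with hμ
  set I : Finset (Fin S) := {i | i.val < m} with hI
  have hIcard : I.card = m := card_filter_val_lt hmS
  set r : NNReal := ((n : ℝ) / m).toNNReal with hr
  have hrr : (r : ℝ) = n / m := Real.coe_toNNReal _ (by positivity)
  have hr0 : 0 < r := Real.toNNReal_pos.2 (by positivity)
  have hμI : ∀ i ∈ I, μ i = ProbabilityTheory.poissonMeasure r := fun i hi => by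
    have hi' : i.val < m := (Finset.mem_filter.1 hi).2
    simp only [hμ, hr, uniformOnFirst, hi', if_true, mul_one_div]
  have hbad := measure_pi_sum_lt_le (μ := μ) (f := tangentGap α (n / m)) (I := I)
    (a := 2 * t) (V := V) ht (Finset.card_pos.1 (hIcard ▸ hm0))
    (fun i hi => by rw [hμI i hi, ← hrr]; exact memLp_tangentGap α r)
    (fun i hi => by
      rw [hμI i hi, ← hrr, integral_tangentGap, ht_def, hrr, mul_div_cancel₀ _ two_ne_zero]
      gcongr)
    (fun i hi => by
      rw [hμI i hi, ← hrr]
      refine (variance_tangentGap_le α hr0).trans ?_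
      have : 2 * α ^ 2 / r ≤ 4 * α ^ 2 / c := by
        rw [hrr]
        calc 2 * α ^ 2 / ((n : ℝ) / m) ≤ 2 * α ^ 2 / (c / 2) := by gcongr
          _ = _ := by ring
      linarith)
  have hε_bound : V / (I.card * t ^ 2) ≤ ε := by
    rw [hIcard, div_le_iff₀ (by positivity)]
    have h1 : c * (V / (ε * t ^ 2)) ≤ c * m := by
      rw [div_le_iff₀ hc] at hm_ge
      linarith
    have h2 := le_of_mul_le_mul_left h1 hc
    rw [div_le_iff₀ (by positivity)] at h2
    linarith
  set A : Set (Fin S → ℕ) := {z | Real.log (1 + t) / (α - 1) ≤ |(1 / (1 - α)) *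
    Real.log (∑ i, ((z i : ℝ) / (n : ℝ)) ^ α) - renyi S α (uniformOnFirst S m)|} with hA
  have hAc : Aᶜ ⊆ {z | ∑ i ∈ I, tangentGap α (n / m) (z i) < I.card * (2 * t - t)} := by
    intro z hz
    by_contra hcon
    refine hz ?_
    rw [Set.mem_ofPred_eq, not_lt, hIcard, two_mul, add_sub_cancel_right] at hcon
    refine log_div_le_abs_renyi_diff hα1 ht ?_
      (mul_Falpha_uniformOnFirst_le hm0 (by exact_mod_cast hn0) hmS hα1 hcon)
    rw [Falpha_uniformOnFirst hmS (by linarith)]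
    positivity
  have hAc' : Measure.pi μ Aᶜ ≤ ENNReal.ofReal ε :=
    (measure_mono hAc).trans (hbad.trans (ENNReal.ofReal_le_ofReal hε_bound))
  have hcompl := prob_compl_eq_one_sub (μ := Measure.pi μ) (A.to_countable.measurableSet.compl)
  rw [compl_compl] at hcompl
  rw [hcompl, ENNReal.ofReal_sub _ hε.le, ENNReal.ofReal_one]
  gcongr
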